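/- Let E ⊂ ℝⁿ be a convex body (compact convex with nonempty interior). Then for all ρ ≥ 0 the n-dimensional volume of the set of points within distance ρ of E is a polynomial in ρ of degree n: Vol_n({x : dist(x, E) ≤ ρ}) = Σ_{j=0}^n ω_{n-j} ρ^{n-j} 𝓛_j(E), where ω_d = π^{d/2}/Γ(d/2 + 1) is the volume of the unit d-ball and 𝓛_j(E) are the intrinsic volumes (Lipschitz–Killing curvatures) of E. -/

import Mathlib

open Real MeasureTheory Metric

/-- `ω_d = π^{d/2}/Γ(d/2+1)`, the volume of the unit ball in `ℝ^d`. -/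
noncomputable def unitBallVol (d : ℕ) : ℝ :=
  Real.pi ^ ((d : ℝ) / 2) / Real.Gamma ((d : ℝ) / 2 + 1)

/-- `p` sends each point to its nearest point in the convex set `E`, expressed by the variational
inequality. -/
structure IsNearestPointMap {F : Type*} [NormedAddCommGroup F] [InnerProductSpace ℝ F]
    (E : Set F) (p : F → F) : Prop where
  mem : ∀ x, p x ∈ E
  inner_le : ∀ x, ∀ w ∈ E, inner ℝ (x - p x) (w - p x) ≤ 0

section NearestPoint

variable {F : Type*} [NormedAddCommGroup F] [InnerProductSpace ℝ F] {E : Set F} {p : F → F}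

theorem exists_isNearestPointMap (hne : E.Nonempty) (hcomp : IsComplete E) (hconv : Convex ℝ E) :
    ∃ p : F → F, IsNearestPointMap E p := by
  choose p hp hmin using exists_norm_eq_iInf_of_complete_convex hne hcomp hconv
  exact ⟨p, hp, fun x ↦ (norm_eq_iInf_iff_real_inner_le_zero hconv (hp x)).1 (hmin x)⟩

/-- The radial expansion away from a convex set with nearest-point map `p`. -/
def outwardDilation (p : F → F) (t : ℝ) (x : F) : F := x + t • (x - p x)

namespace IsNearestPointMap

theorem norm_sub_le (hp : IsNearestPointMap E p) (x y : F) : ‖p x - p y‖ ≤ ‖x - y‖ := by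
  have h1 := hp.inner_le x (p y) (hp.mem y)
  have h2 := hp.inner_le y (p x) (hp.mem x)
  have h3 : ‖p x - p y‖ ^ 2 ≤ inner ℝ (x - y) (p x - p y) := by
    have e : inner ℝ (x - y) (p x - p y) - ‖p x - p y‖ ^ 2 =
        -inner ℝ (x - p x) (p y - p x) - inner ℝ (y - p y) (p x - p y) := by
      rw [← real_inner_self_eq_norm_sq, ← inner_sub_left, ← inner_neg_right, neg_sub,
        ← inner_sub_left]
      congr 1
      abel
    linarith
  have h4 := real_inner_le_norm (x - y) (p x - p y)
  by_contra! h
  nlinarith [norm_nonneg (x - y)]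

theorem lipschitzWith (hp : IsNearestPointMap E p) : LipschitzWith 1 p :=
  LipschitzWith.of_dist_le_mul fun x y ↦ by simpa [dist_eq_norm] using hp.norm_sub_le x y

theorem infDist_eq (hp : IsNearestPointMap E p) (x : F) : infDist x E = ‖x - p x‖ := by
  refine le_antisymm ?_ ?_
  · rw [← dist_eq_norm]
    exact infDist_le_dist_of_mem (hp.mem x)
  · refine (le_infDist ⟨p x, hp.mem x⟩).2 fun w hw ↦ ?_
    rw [dist_eq_norm]
    have h := hp.inner_le x w hw
    have e := norm_sub_sq_real (x - p x) (w - p x)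
    rw [sub_sub_sub_cancel_right] at e
    rw [← abs_norm (x - p x), ← abs_norm (x - w), ← sq_le_sq, e]
    nlinarith [sq_nonneg ‖w - p x‖]

theorem eq_of_inner_le (hp : IsNearestPointMap E p) {x y : F} (hy : y ∈ E)
    (h : ∀ w ∈ E, inner ℝ (x - y) (w - y) ≤ 0) : p x = y := by
  have h1 := hp.inner_le x y hy
  have h2 := h (p x) (hp.mem x)
  have e : inner ℝ (x - p x) (y - p x) + inner ℝ (x - y) (p x - y) = ‖p x - y‖ ^ 2 := by
    rw [← real_inner_self_eq_norm_sq, ← neg_sub (p x) y, inner_neg_right, neg_add_eq_sub,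
      ← inner_sub_left]
    congr 1
    abel
  have : ‖p x - y‖ = 0 := by nlinarith [norm_nonneg (p x - y)]
  exact sub_eq_zero.1 (norm_eq_zero.1 this)

theorem apply_add_smul (hp : IsNearestPointMap E p) (x : F) {c : ℝ} (hc : 0 ≤ c) :
    p (p x + c • (x - p x)) = p x := by
  refine hp.eq_of_inner_le (hp.mem x) fun w hw ↦ ?_
  rw [add_sub_cancel_left, real_inner_smul_left]
  exact mul_nonpos_of_nonneg_of_nonpos hc (hp.inner_le x w hw)

theorem outwardDilation_eq (x : F) (t : ℝ) :
    outwardDilation p t x = p x + (1 + t) • (x - p x) := by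
  unfold outwardDilation
  module

theorem outwardDilation_injective (hp : IsNearestPointMap E p) {t : ℝ} (ht : 0 ≤ t) :
    Function.Injective (outwardDilation p t) := by
  intro x y hxy
  have h : (1 + t) • (x - y) = t • (p x - p y) := by
    rw [← sub_eq_zero] at hxy ⊢
    rw [← hxy]
    unfold outwardDilation
    module
  have h' := congrArg norm h
  rw [norm_smul, norm_smul, Real.norm_of_nonneg ht, Real.norm_of_nonneg (by linarith)] at h'
  have := mul_le_mul_of_nonneg_left (hp.norm_sub_le x y) ht
  have : ‖x - y‖ = 0 := by nlinarith [norm_nonneg (x - y)]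
  exact sub_eq_zero.1 (norm_eq_zero.1 this)

theorem outwardDilation_image (hp : IsNearestPointMap E p) {t : ℝ} (ht : 0 ≤ t) (s : ℝ) :
    outwardDilation p t '' {x | infDist x E ≤ s} = {x | infDist x E ≤ s * (1 + t)} := by
  have ht' : 0 < 1 + t := by linarith
  ext z
  simp only [Set.mem_image, Set.mem_ofPred_eq]
  constructor
  · rintro ⟨x, hx, rfl⟩
    rw [hp.infDist_eq] at hx ⊢
    rw [outwardDilation_eq, hp.apply_add_smul x ht'.le, add_sub_cancel_left, norm_smul,
      Real.norm_of_nonneg ht'.le, mul_comm]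
    gcongr
  · intro hz
    have hpz := hp.apply_add_smul z (inv_nonneg.2 ht'.le)
    refine ⟨p z + (1 + t)⁻¹ • (z - p z), ?_, ?_⟩
    · rw [hp.infDist_eq] at hz ⊢
      rw [hpz, add_sub_cancel_left, norm_smul, Real.norm_of_nonneg (inv_nonneg.2 ht'.le),
        inv_mul_le_iff₀ ht', mul_comm]
      exact hz
    · rw [outwardDilation_eq, hpz, add_sub_cancel_left, smul_inv_smul₀ ht'.ne', add_sub_cancel]

theorem lipschitzWith_outwardDilation (hp : IsNearestPointMap E p) (t : ℝ) :
    ∃ K, LipschitzWith K (outwardDilation p t) :=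
  ⟨_, LipschitzWith.id.add ((lipschitzWith_smul t).comp (LipschitzWith.id.sub hp.lipschitzWith))⟩

theorem inner_sub_fderiv_nonneg (hp : IsNearestPointMap E p) (x v : F) :
    0 ≤ inner ℝ ((ContinuousLinearMap.id ℝ F - fderiv ℝ p x) v) v := by
  have h : ‖fderiv ℝ p x v‖ ≤ ‖v‖ := by
    simpa using (fderiv ℝ p x).le_of_opNorm_le (norm_fderiv_le_of_lipschitz ℝ hp.lipschitzWith) v
  have h' := real_inner_le_norm (fderiv ℝ p x v) v
  have : inner ℝ ((ContinuousLinearMap.id ℝ F - fderiv ℝ p x) v) v =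
      ‖v‖ ^ 2 - inner ℝ (fderiv ℝ p x v) v := by
    simp [inner_sub_left]
  rw [this]
  nlinarith [norm_nonneg v]

end IsNearestPointMap

end NearestPoint

section Determinant

variable {F : Type*} [NormedAddCommGroup F] [InnerProductSpace ℝ F] [FiniteDimensional ℝ F]

theorem exists_polynomial_eval_eq_det (M : F →L[ℝ] F) :
    ∃ q : Polynomial ℝ, q.natDegree ≤ Module.finrank ℝ F ∧
      ∀ t, q.eval t = (ContinuousLinearMap.id ℝ F + t • M).det := by
  let b := Module.finBasis ℝ F
  let A := LinearMap.toMatrix b b (M : F →ₗ[ℝ] F)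
  refine ⟨_, (Polynomial.natDegree_det_X_add_C_le A 1).trans_eq (Fintype.card_fin _), fun t ↦ ?_⟩
  rw [ContinuousLinearMap.det, ← LinearMap.det_toMatrix b, ← Polynomial.coe_evalRingHom,
    RingHom.map_det]
  congr 1
  ext i j
  by_cases h : i = j <;>
    simp [A, h, LinearMap.toMatrix_apply, add_comm, mul_comm t]

theorem det_id_add_smul_pos {M : F →L[ℝ] F} (hM : ∀ v, 0 ≤ inner ℝ (M v) v) {t : ℝ}
    (ht : 0 ≤ t) : 0 < (ContinuousLinearMap.id ℝ F + t • M).det := by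
  obtain ⟨q, -, hq⟩ := exists_polynomial_eval_eq_det M
  have hne : ∀ s, 0 ≤ s → q.eval s ≠ 0 := by
    intro s hs h0
    rw [hq, ContinuousLinearMap.det] at h0
    obtain ⟨v, hv, hv0⟩ := (Submodule.ne_bot_iff _).1 (LinearMap.bot_lt_ker_of_det_eq_zero h0).ne'
    have h : v + s • M v = 0 := by simpa using hv
    have h' : inner ℝ (v + s • M v) v = 0 := by rw [h, inner_zero_left]
    rw [inner_add_left, real_inner_smul_left, real_inner_self_eq_norm_sq] at h'
    have := norm_pos_iff.2 hv0
    nlinarith [mul_nonneg hs (hM v)]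
  have h0 : q.eval 0 = 1 := by simp [hq, ContinuousLinearMap.det]
  rw [← hq]
  by_contra! hneg
  obtain ⟨s, hs, hs0⟩ := intermediate_value_Icc' ht q.continuous.continuousOn
    (show (0 : ℝ) ∈ Set.Icc (q.eval t) (q.eval 0) from ⟨hneg, by simp [h0]⟩)
  exact hne s hs.1 hs0

end Determinant

section Volume

variable {F : Type*} [NormedAddCommGroup F] [InnerProductSpace ℝ F] [FiniteDimensional ℝ F]
  [MeasurableSpace F] [BorelSpace F]

theorem LipschitzWith.addHaar_image_eq_zero {f : F → F} {K : NNReal} (hf : LipschitzWith K f)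
    (μ : Measure F) [μ.IsAddHaarMeasure] {N : Set F} (hN : μ N = 0) : μ (f '' N) = 0 := by
  have h1 : μH[Module.finrank ℝ F] N = 0 :=
    Measure.absolutelyContinuous_isAddHaarMeasure _ μ hN
  refine Measure.absolutelyContinuous_isAddHaarMeasure μ μH[Module.finrank ℝ F] ?_
  have h2 := hf.hausdorffMeasure_image_le (Nat.cast_nonneg (Module.finrank ℝ F)) N
  simpa [h1] using h2

variable {E : Set F} {p : F → F}

/-- The volume of a parallel set of `E` as the integral of the Jacobian of the dilation. -/
theorem IsNearestPointMap.measure_eq_integral (hp : IsNearestPointMap E p) (μ : Measure F)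
    [μ.IsAddHaarMeasure] (hfin : ∀ r, μ {x | infDist x E ≤ r} ≠ ⊤) (s : ℝ) {t : ℝ} (ht : 0 ≤ t) :
    IntegrableOn (fun x ↦ (ContinuousLinearMap.id ℝ F +
        t • (ContinuousLinearMap.id ℝ F - fderiv ℝ p x)).det)
      ({x | infDist x E ≤ s} ∩ {x | DifferentiableAt ℝ p x}) μ ∧
    μ.real {x | infDist x E ≤ s * (1 + t)} =
      ∫ x in {x | infDist x E ≤ s} ∩ {x | DifferentiableAt ℝ p x},
        (ContinuousLinearMap.id ℝ F +
          t • (ContinuousLinearMap.id ℝ F - fderiv ℝ p x)).det ∂μ := by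
  set S := {x | infDist x E ≤ s} ∩ {x | DifferentiableAt ℝ p x}
  set f := outwardDilation p t
  set f' := fun x ↦ ContinuousLinearMap.id ℝ F +
    t • (ContinuousLinearMap.id ℝ F - fderiv ℝ p x)
  have hS : MeasurableSet S :=
    (isClosed_le (continuous_infDist_pt E) continuous_const).measurableSet.inter
      (measurableSet_of_differentiableAt ℝ p)
  have hf' : ∀ x ∈ S, HasFDerivWithinAt f (f' x) S x := fun x hx ↦
    ((hasFDerivAt_id x).add
      (((hasFDerivAt_id x).sub hx.2.hasFDerivAt).const_smul t)).hasFDerivWithinAt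
  have hinj : S.InjOn f := (hp.outwardDilation_injective ht).injOn
  have hdet : ∀ x, |(f' x).det| = (f' x).det := fun x ↦
    abs_of_pos (det_id_add_smul_pos (hp.inner_sub_fderiv_nonneg x) ht)
  have himage : μ (f '' S) = μ {x | infDist x E ≤ s * (1 + t)} := by
    rw [← hp.outwardDilation_image ht s]
    obtain ⟨K, hK⟩ := hp.lipschitzWith_outwardDilation t
    have hnull : μ {x | ¬ DifferentiableAt ℝ p x} = 0 := hp.lipschitzWith.ae_differentiableAt
    refine measure_eq_measure_of_null_sdiff (Set.image_mono Set.inter_subset_left) ?_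
    refine measure_mono_null ?_ (hK.addHaar_image_eq_zero μ hnull)
    rintro _ ⟨⟨x, hx, rfl⟩, hx'⟩
    exact ⟨x, fun hd ↦ hx' ⟨x, ⟨hx, hd⟩, rfl⟩, rfl⟩
  have hint := integrableOn_image_iff_integrableOn_abs_det_fderiv_smul μ hS hf' hinj
    (fun _ ↦ (1 : ℝ))
  have heq := integral_image_eq_integral_abs_det_fderiv_smul μ hS hf' hinj (fun _ ↦ (1 : ℝ))
  simp only [hdet, smul_eq_mul, mul_one] at hint heq
  refine ⟨hint.1 (integrableOn_const (himage ▸ hfin _)), ?_⟩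
  rw [← heq, setIntegral_const, smul_eq_mul, mul_one, measureReal_def, measureReal_def, himage]

theorem IsNearestPointMap.exists_polynomial_of_le (hp : IsNearestPointMap E p) (μ : Measure F)
    [μ.IsAddHaarMeasure] (hfin : ∀ r, μ {x | infDist x E ≤ r} ≠ ⊤) {s : ℝ} (hs : 0 < s) :
    ∃ q : Polynomial ℝ, q.natDegree ≤ Module.finrank ℝ F ∧
      ∀ r, s ≤ r → μ.real {x | infDist x E ≤ r} = q.eval r := by
  set n := Module.finrank ℝ F
  set S := {x | infDist x E ≤ s} ∩ {x | DifferentiableAt ℝ p x}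
  let D : ℝ → F → ℝ := fun t x ↦ (ContinuousLinearMap.id ℝ F +
    t • (ContinuousLinearMap.id ℝ F - fderiv ℝ p x)).det
  have hD := fun t (ht : 0 ≤ t) ↦ hp.measure_eq_integral μ hfin s ht
  let I := Finset.range (n + 1)
  let v : ℕ → ℝ := (↑)
  have hv : Set.InjOn v I := Nat.cast_injective.injOn
  have hDt : ∀ t x, D t x = ∑ i ∈ I, D i x * (Lagrange.basis I v i).eval t := by
    intro t x
    obtain ⟨q, hqn, hq⟩ :=
      exists_polynomial_eval_eq_det (ContinuousLinearMap.id ℝ F - fderiv ℝ p x)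
    have hlt : q.degree < I.card := by
      rw [Finset.card_range]
      exact Polynomial.degree_le_natDegree.trans_lt (by exact_mod_cast Nat.lt_succ_of_le hqn)
    have h := congrArg (Polynomial.eval t) (Lagrange.eq_interpolate hv hlt)
    simpa [Lagrange.interpolate_apply, Polynomial.eval_finsetSum, hq] using h
  let W := Lagrange.interpolate I v fun i ↦ μ.real {x | infDist x E ≤ s * (1 + i)}
  have hW : W.natDegree ≤ n := by
    have h : W.degree < I.card := Lagrange.degree_interpolate_lt _ hv
    rw [Finset.card_range] at h
    exact Polynomial.natDegree_le_of_degree_le (Order.le_of_lt_succ (by exact_mod_cast h))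
  refine ⟨W.comp (Polynomial.C s⁻¹ * Polynomial.X - Polynomial.C 1), ?_, fun r hr ↦ ?_⟩
  · rw [Polynomial.natDegree_comp]
    have : (Polynomial.C s⁻¹ * Polynomial.X - Polynomial.C 1 : Polynomial ℝ).natDegree ≤ 1 := by
      compute_degree
    nlinarith
  · have ht : 0 ≤ s⁻¹ * r - 1 := by
      rw [sub_nonneg, ← div_eq_inv_mul]
      exact (one_le_div hs).2 hr
    have hr' : r = s * (1 + (s⁻¹ * r - 1)) := by field_simp; ring
    rw [Polynomial.eval_comp]
    simp only [Polynomial.eval_sub, Polynomial.eval_mul, Polynomial.eval_C, Polynomial.eval_X]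
    generalize s⁻¹ * r - 1 = t at ht hr'
    rw [hr', (hD t ht).2]
    change ∫ x in S, D t x ∂μ = _
    simp only [hDt t, W, Lagrange.interpolate_apply, Polynomial.eval_finsetSum,
      Polynomial.eval_mul, Polynomial.eval_C]
    rw [integral_finsetSum _ fun i _ ↦ ((hD (i : ℕ) (Nat.cast_nonneg i)).1.mul_const _ :)]
    refine Finset.sum_congr rfl fun i _ ↦ ?_
    rw [integral_mul_const, (hD i (Nat.cast_nonneg i)).2]

/-- The volume of the parallel sets of a compact convex set is a polynomial in the radius. -/
theorem exists_polynomial_measure_parallelSet (μ : Measure F) [μ.IsAddHaarMeasure]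
    (hne : E.Nonempty) (hcomp : IsCompact E) (hconv : Convex ℝ E) :
    ∃ q : Polynomial ℝ, q.natDegree ≤ Module.finrank ℝ F ∧
      ∀ r, 0 ≤ r → μ.real {x | infDist x E ≤ r} = q.eval r := by
  obtain ⟨p, hp⟩ := exists_isNearestPointMap hne hcomp.isComplete hconv
  have hset : ∀ r, 0 ≤ r → {x | infDist x E ≤ r} = cthickening r E := fun r hr ↦ by
    ext x
    rw [mem_cthickening_iff, Set.mem_ofPred_eq, infDist,
      ENNReal.le_ofReal_iff_toReal_le (infEDist_ne_top hne) hr]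
  have hfin : ∀ r, μ {x | infDist x E ≤ r} ≠ ⊤ := fun r ↦ by
    have hsub : {x | infDist x E ≤ r} ⊆ {x | infDist x E ≤ max r 0} :=
      fun x (hx : infDist x E ≤ r) ↦ hx.trans (le_max_left r 0)
    refine measure_ne_top_of_subset hsub ?_
    rw [hset _ (le_max_right _ _)]
    exact hcomp.cthickening.measure_lt_top.ne
  obtain ⟨q, hqn, hq⟩ := hp.exists_polynomial_of_le μ hfin one_pos
  have hpos : ∀ r, 0 < r → μ.real {x | infDist x E ≤ r} = q.eval r := by
    intro r hr
    obtain ⟨q', -, hq'⟩ := hp.exists_polynomial_of_le μ hfin hr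
    have : q' = q := Polynomial.eq_of_infinite_eval_eq _ _ <|
      (Set.Ici_infinite (max 1 r)).mono fun x hx ↦ by
        rw [Set.mem_Ici, max_le_iff] at hx
        rw [Set.mem_ofPred_eq, ← hq x hx.1, ← hq' x hx.2]
    rw [hq' r le_rfl, this]
  refine ⟨q, hqn, fun r hr ↦ ?_⟩
  rcases hr.eq_or_lt with rfl | hr
  · have h1 : Filter.Tendsto (fun r ↦ μ.real (cthickening r E)) (nhds 0) (nhds (μ.real E)) :=
      (ENNReal.tendsto_toReal hcomp.measure_lt_top.ne).comp
        (tendsto_measure_cthickening_of_isCompact hcomp)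
    have h2 : Filter.Tendsto (fun r ↦ μ.real (cthickening r E)) (nhdsWithin 0 (Set.Ioi 0))
        (nhds (q.eval 0)) := by
      refine ((q.continuous.tendsto 0).mono_left nhdsWithin_le_nhds).congr' ?_
      filter_upwards [self_mem_nhdsWithin] with r hr
      rw [← hpos r hr, hset r (Set.mem_Ioi.1 hr).le]
    rw [← tendsto_nhds_unique (h1.mono_left nhdsWithin_le_nhds) h2, hset 0 le_rfl,
      cthickening_zero, hcomp.isClosed.closure_eq]
  · exact hpos r hr

theorem mul_pow_finrank_le_measure_parallelSet (μ : Measure F) [μ.IsAddHaarMeasure]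
    (hcomp : IsCompact E) (hne : E.Nonempty) {r : ℝ} (hr : 0 ≤ r) :
    r ^ Module.finrank ℝ F * μ.real (ball 0 1) ≤ μ.real {x | infDist x E ≤ r} := by
  obtain ⟨a, ha⟩ := hne
  have hbd : Bornology.IsBounded {x | infDist x E ≤ r} := by
    refine hcomp.isBounded.cthickening (δ := r) |>.subset fun x hx ↦ ?_
    rw [mem_cthickening_iff, ENNReal.le_ofReal_iff_toReal_le (infEDist_ne_top ⟨a, ha⟩) hr]
    exact hx
  rw [← Measure.addHaar_real_closedBall μ a hr]
  exact measureReal_mono (fun x hx ↦ (infDist_le_dist_of_mem ha).trans hx)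
    hbd.measure_lt_top.ne

theorem measure_parallelSet_le_mul_pow_finrank (μ : Measure F) [μ.IsAddHaarMeasure]
    (hne : E.Nonempty) {a : F} {R : ℝ} (hR : 0 ≤ R) (hE : E ⊆ closedBall a R)
    {r : ℝ} (hr : 0 ≤ r) :
    μ.real {x | infDist x E ≤ r} ≤ (R + r) ^ Module.finrank ℝ F * μ.real (ball 0 1) := by
  rw [← Measure.addHaar_real_closedBall μ a (add_nonneg hR hr)]
  refine measureReal_mono (fun x hx ↦ ?_) measure_closedBall_lt_top.ne
  have h : dist x a - R ≤ infDist x E := (le_infDist hne).2 fun w hw ↦ by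
    have h1 := dist_triangle x w a
    have h2 : dist w a ≤ R := hE hw
    linarith
  have hx' : infDist x E ≤ r := hx
  rw [mem_closedBall]
  linarith

/-- The top coefficient of the volume polynomial is the volume of the unit ball. -/
theorem coeff_finrank_eq_measure_ball (μ : Measure F) [μ.IsAddHaarMeasure]
    (hne : E.Nonempty) (hcomp : IsCompact E) {q : Polynomial ℝ}
    (hqn : q.natDegree ≤ Module.finrank ℝ F)
    (hq : ∀ r, 0 ≤ r → μ.real {x | infDist x E ≤ r} = q.eval r) :
    q.coeff (Module.finrank ℝ F) = μ.real (ball 0 1) := by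
  set n := Module.finrank ℝ F
  obtain ⟨R, hR⟩ := hcomp.isBounded.subset_closedBall (0 : F)
  have hR' : E ⊆ closedBall 0 (max R 0) := hR.trans (closedBall_subset_closedBall (le_max_left _ _))
  let g : ℝ → ℝ := fun r ↦ ∑ i ∈ Finset.range (n + 1), q.coeff i * r ^ (n - i)
  have hg : ∀ r, 0 < r → g r = r ^ n * μ.real {x | infDist x E ≤ r⁻¹} := by
    intro r hr
    rw [hq _ (inv_nonneg.2 hr.le), Polynomial.eval_eq_sum_range' (Nat.lt_succ_of_le hqn),
      Finset.mul_sum]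
    refine Finset.sum_congr rfl fun i hi ↦ ?_
    rw [pow_sub₀ r hr.ne' (Nat.lt_succ_iff.1 (Finset.mem_range.1 hi)), inv_pow]
    ring
  have hg0 : g 0 = q.coeff n := by
    simp only [g, Finset.sum_range_succ, Nat.sub_self, pow_zero, mul_one, add_eq_right]
    refine Finset.sum_eq_zero fun i hi ↦ ?_
    rw [zero_pow (Nat.sub_ne_zero_of_lt (Finset.mem_range.1 hi)), mul_zero]
  have hgt : Filter.Tendsto g (nhdsWithin 0 (Set.Ioi 0)) (nhds (q.coeff n)) := by
    rw [← hg0]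
    exact (Continuous.tendsto (by fun_prop) 0).mono_left nhdsWithin_le_nhds
  have hut : Filter.Tendsto (fun r ↦ (max R 0 * r + 1) ^ n * μ.real (ball 0 1))
      (nhdsWithin 0 (Set.Ioi 0)) (nhds (μ.real (ball 0 1))) := by
    have h : Continuous fun r : ℝ ↦ (max R 0 * r + 1) ^ n * μ.real (ball 0 1) := by fun_prop
    simpa using (h.tendsto 0).mono_left nhdsWithin_le_nhds
  refine tendsto_nhds_unique hgt (tendsto_of_tendsto_of_tendsto_of_le_of_le'
    tendsto_const_nhds hut ?_ ?_)
  · filter_upwards [self_mem_nhdsWithin] with r (hr : 0 < r)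
    have h := mul_pow_finrank_le_measure_parallelSet μ hcomp hne (inv_nonneg.2 hr.le)
    rw [inv_pow, inv_mul_le_iff₀ (by positivity)] at h
    rwa [hg r hr]
  · filter_upwards [self_mem_nhdsWithin] with r (hr : 0 < r)
    have h := measure_parallelSet_le_mul_pow_finrank μ hne (le_max_right R 0) hR'
      (inv_nonneg.2 hr.le)
    rw [hg r hr]
    refine (mul_le_mul_of_nonneg_left h (by positivity)).trans_eq ?_
    rw [← mul_assoc, ← mul_pow, mul_add, mul_inv_cancel₀ hr.ne', mul_comm r]

end Volume

theorem unitBallVol_pos (d : ℕ) : 0 < unitBallVol d :=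
  div_pos (rpow_pos_of_pos pi_pos _) (Gamma_pos_of_pos (by positivity))

theorem volume_real_ball_eq_unitBallVol (n : ℕ) :
    volume.real (ball (0 : EuclideanSpace ℝ (Fin n)) 1) = unitBallVol n := by
  rcases Nat.eq_zero_or_pos n with rfl | hn
  · have h : ball (0 : EuclideanSpace ℝ (Fin 0)) 1 = Set.univ :=
      Set.eq_univ_of_forall fun x ↦ by simp [Subsingleton.elim x 0]
    have hmp := (EuclideanSpace.volume_preserving_symm_measurableEquiv_toLp (Fin 0)).measure_preimage
      MeasurableSet.univ.nullMeasurableSet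
    rw [Set.preimage_univ] at hmp
    rw [h, measureReal_def, hmp, volume_pi, Measure.pi_univ]
    simp [unitBallVol]
  · have : Nonempty (Fin n) := ⟨⟨0, hn⟩⟩
    have h : √π ^ n = π ^ ((n : ℝ) / 2) := by
      rw [sqrt_eq_rpow, ← rpow_natCast, ← rpow_mul pi_pos.le]
      congr 1
      ring
    rw [measureReal_def, EuclideanSpace.volume_ball]
    simp only [Fintype.card_fin, ENNReal.ofReal_one, one_pow, one_mul, h]
    exact ENNReal.toReal_ofReal (unitBallVol_pos n).le

/-- Steiner formula: for a convex body `E ⊂ ℝⁿ` there exist coefficients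
`𝓛_j(E)` (the intrinsic volumes, with `𝓛_n(E) = Vol_n(E)` and `𝓛_0(E) = 1`)
such that for every `ρ ≥ 0`,
`Vol_n({x : dist(x,E) ≤ ρ}) = Σ_{j=0}^n ω_{n-j} ρ^{n-j} 𝓛_j(E)`. -/
theorem stmt_10 (n : ℕ) (E : Set (EuclideanSpace ℝ (Fin n)))
    (hconv : Convex ℝ E) (hcomp : IsCompact E) (hint : (interior E).Nonempty) :
    ∃ L : ℕ → ℝ, L n = (volume E).toReal ∧ L 0 = 1 ∧
      ∀ ρ : ℝ, 0 ≤ ρ →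
        (volume {x : EuclideanSpace ℝ (Fin n) | infDist x E ≤ ρ}).toReal =
          ∑ j ∈ Finset.range (n + 1),
            unitBallVol (n - j) * ρ ^ (n - j) * L j := by
  have hne : E.Nonempty := hint.mono interior_subset
  obtain ⟨q, hqn, hq⟩ :=
    exists_polynomial_measure_parallelSet (volume : Measure (EuclideanSpace ℝ (Fin n)))
      hne hcomp hconv
  have htop := coeff_finrank_eq_measure_ball volume hne hcomp hqn hq
  rw [finrank_euclideanSpace_fin] at hqn htop
  rw [volume_real_ball_eq_unitBallVol] at htop
  refine ⟨fun j ↦ q.coeff (n - j) / unitBallVol (n - j), ?_, ?_, fun ρ hρ ↦ ?_⟩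
  · have h0 := hq 0 le_rfl
    have hE : {x | infDist x E ≤ 0} = E := by
      ext x
      rw [Set.mem_ofPred_eq, hcomp.isClosed.mem_iff_infDist_zero hne]
      exact ⟨fun h ↦ le_antisymm h infDist_nonneg, le_of_eq⟩
    rw [hE, measureReal_def] at h0
    simp [h0, unitBallVol, Polynomial.coeff_zero_eq_eval_zero]
  · simp only [Nat.sub_zero, htop]
    exact div_self (unitBallVol_pos n).ne'
  · rw [← measureReal_def, hq ρ hρ, Polynomial.eval_eq_sum_range' (Nat.lt_succ_of_le hqn),
      ← Finset.sum_range_reflect]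
    refine Finset.sum_congr rfl fun j _ ↦ ?_
    rw [show n + 1 - 1 - j = n - j by omega]
    have := (unitBallVol_pos (n - j)).ne'
    field_simp
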